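/- arXiv:1609.03623 — 3 statements merged into one kernel-verified Lean document; each statement's English description precedes it below -/
import Mathlib

section
/- Let G be a finite connected simple graph, let a and b be two distinct vertices of G, and let τ be a natural number. Suppose that every separating edge set for a and b contains at least τ edges (equivalently, a and b are τ'-edge separated for some τ' ≥ τ). Then there exist τ paths in G connecting a to b that are pairwise edge-disjoint. -/
/-- An integral flow of value `k` from `a` to `b` in `G`, all edges having capacity one. -/
structure IsUnitCapacityFlow {V : Type*} [Fintype V] [DecidableEq V] (G : SimpleGraph V)
    (f : V → V → ℤ) (a b : V) (k : ℤ) : Prop where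
  antisymm : ∀ u v, f u v = -f v u
  adj : ∀ u v, f u v ≠ 0 → G.Adj u v
  le_one : ∀ u v, f u v ≤ 1
  net : ∀ u, ∑ v, f u v = k * ((if u = a then 1 else 0) - (if u = b then 1 else 0))

namespace IsUnitCapacityFlow

variable {V : Type*} [Fintype V] [DecidableEq V] {G : SimpleGraph V} {a b : V}

theorem sum_cut {f : V → V → ℤ} {k : ℤ} (hf : IsUnitCapacityFlow G f a b k) {S : Finset V}
    (ha : a ∈ S) (hb : b ∉ S) : ∑ u ∈ S, ∑ v ∈ Sᶜ, f u v = k := by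
  have hnet : ∑ u ∈ S, ∑ v, f u v = k := by
    simp [hf.net, ← Finset.mul_sum, Finset.sum_sub_distrib, ha, hb]
  have hinner : ∑ u ∈ S, ∑ v ∈ S, f u v = 0 := by
    have hneg : ∑ u ∈ S, ∑ v ∈ S, f u v = -∑ u ∈ S, ∑ v ∈ S, f u v := by
      conv_lhs => rw [Finset.sum_comm]
      simp only [← Finset.sum_neg_distrib]
      exact Finset.sum_congr rfl fun u _ => Finset.sum_congr rfl fun v _ => hf.antisymm v u
    omega
  simp only [← Finset.sum_add_sum_compl S, Finset.sum_add_distrib] at hnet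
  omega

/-- If every cut separating `a` from `b` contains an arc of `R`, then some path from `a` to `b`
carries a flow of value one along arcs of `R`. -/
theorem exists_path (R : V → V → Prop) (hR : ∀ u v, R u v → G.Adj u v)
    (hcut : ∀ S : Finset V, a ∈ S → b ∉ S → ∃ u ∈ S, ∃ v ∉ S, R u v) :
    ∃ (p : G.Path a b) (g : V → V → ℤ), IsUnitCapacityFlow G g a b 1 ∧
      (∀ u v, g u v = 1 → R u v) ∧ ∀ u v, s(u, v) ∈ (p : G.Walk a b).edges → g u v ≠ 0 := by
  classical
  let Good : Finset V → Prop := fun S => a ∈ S ∧ ∀ c ∈ S,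
    ∃ (p : G.Walk a c) (g : V → V → ℤ), p.IsPath ∧ (∀ x ∈ p.support, x ∈ S) ∧
      IsUnitCapacityFlow G g a c 1 ∧ (∀ u v, g u v = 1 → R u v) ∧
      (∀ u v, s(u, v) ∈ p.edges → g u v ≠ 0) ∧ ∀ u v, g u v ≠ 0 → u ∈ S ∧ v ∈ S
  have hgood : Good {a} := by
    refine ⟨by simp, fun c hc => ?_⟩
    obtain rfl := Finset.mem_singleton.1 hc
    exact ⟨.nil, 0, by simp, by simp, ⟨by simp, by simp, by simp, by simp⟩,
      by simp, by simp, by simp⟩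
  obtain ⟨S, hS, hmax⟩ := (Set.toFinite {S | Good S}).exists_maximal ⟨_, hgood⟩
  by_cases hb : b ∈ S
  · obtain ⟨p, g, hp, -, hg, hgR, hpg, -⟩ := hS.2 b hb
    exact ⟨⟨p, hp⟩, g, hg, hgR, hpg⟩
  obtain ⟨c, hc, w, hw, hcw⟩ := hcut S hS.1 hb
  refine absurd (hmax (y := insert w S) ⟨by simp [hS.1], fun d hd => ?_⟩
    (Finset.subset_insert w S) (Finset.mem_insert_self w S)) hw
  rcases Finset.mem_insert.1 hd with rfl | hd
  swap
  · obtain ⟨p, g, hp, hpS, hg, hgR, hpg, hgS⟩ := hS.2 d hd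
    exact ⟨p, g, hp, fun x hx => by simp [hpS x hx], hg, hgR, hpg,
      fun u v h => by simp [hgS u v h]⟩
  obtain ⟨p, g, hp, hpS, hg, hgR, hpg, hgS⟩ := hS.2 c hc
  have hne : c ≠ d := fun h => hw (h ▸ hc)
  have hgd : ∀ u, g u d = 0 := fun u => by_contra fun h => hw (hgS u d h).2
  have hdg : ∀ u, g d u = 0 := fun u => by_contra fun h => hw (hgS d u h).1
  refine ⟨p.concat (hR _ _ hcw),
    fun x y => g x y + (if x = c ∧ y = d then 1 else 0) - (if x = d ∧ y = c then 1 else 0),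
    hp.concat (fun h => hw (hpS _ h)) _, ?_, ⟨?_, ?_, ?_, ?_⟩, ?_, ?_, ?_⟩
  · intro x hx
    simp only [SimpleGraph.Walk.support_concat, List.mem_append,
      List.mem_singleton] at hx
    rcases hx with hx | rfl
    · simp [hpS x hx]
    · simp
  · intro u v
    have := hg.antisymm u v
    grind
  · intro u v h
    have h1 := hg.adj u v
    have h2 := hR _ _ hcw
    have h3 := h2.symm
    grind
  · intro u v
    have := hg.le_one u v
    grind
  · intro u
    have := hg.net u
    simp only [Finset.sum_sub_distrib, Finset.sum_add_distrib, this, ite_and]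
    by_cases h1 : u = c <;> by_cases h2 : u = d <;> simp [h1, h2]
  · intro u v h
    have := hgR u v
    grind
  · intro u v h
    simp only [SimpleGraph.Walk.edges_concat, List.mem_append, List.concat_eq_append,
      List.mem_singleton, Sym2.eq_iff] at h
    have := hpg u v
    grind
  · intro u v h
    have := hgS u v
    grind

theorem augment {f : V → V → ℤ} {k : ℕ} (hf : IsUnitCapacityFlow G f a b k)
    (hsep : ∀ T : Set (Sym2 V), T ⊆ G.edgeSet →
      (∀ p : G.Path a b, ∃ e ∈ T, e ∈ (p : G.Walk a b).edges) → k < T.ncard) :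
    ∃ g, IsUnitCapacityFlow G g a b (k + 1 : ℕ) := by
  classical
  obtain ⟨-, g, hg, hgR, -⟩ := exists_path (G := G) (a := a) (b := b)
    (fun u v => G.Adj u v ∧ f u v ≤ 0) (fun u v h => h.1) (by
      by_contra! h
      obtain ⟨S, ha, hb, hS⟩ := h
      set A := (S ×ˢ Sᶜ).filter fun x => G.Adj x.1 x.2
      have hcard : (A.card : ℤ) = k := by
        rw [← hf.sum_cut ha hb, ← Finset.sum_product', Finset.card_filter, Nat.cast_sum]
        refine Finset.sum_congr rfl fun x hx => ?_
        have h1 := Finset.mem_product.1 hx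
        have h2 := hS x.1 h1.1 x.2 (Finset.mem_compl.1 h1.2)
        have h3 := hf.le_one x.1 x.2
        have h4 := hf.adj x.1 x.2
        split_ifs with hadj
        · have := h2 hadj
          push_cast
          omega
        · by_contra hne
          exact hadj (h4 (Ne.symm hne))
      have hlt := hsep (A.image fun x => s(x.1, x.2) : Finset (Sym2 V)) (by
          intro e he
          simp only [A, Finset.coe_image, Set.mem_image, Finset.mem_coe,
            Finset.mem_filter] at he
          obtain ⟨x, hx, rfl⟩ := he
          exact hx.2) (fun p => by
          obtain ⟨d, hd, h1, h2⟩ := (p : G.Walk a b).exists_boundary_dart (S : Set V)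
            (by simpa using ha) (by simpa using hb)
          refine ⟨d.edge, ?_, List.mem_map_of_mem hd⟩
          simp only [A, Finset.coe_image, Set.mem_image, Finset.mem_coe, Finset.mem_filter,
            Finset.mem_product, Finset.mem_compl]
          exact ⟨d.toProd, ⟨⟨h1, h2⟩, d.adj⟩, rfl⟩)
      rw [Set.ncard_coe_finset] at hlt
      have := Finset.card_image_le (s := A) (f := fun x => s(x.1, x.2))
      omega)
  refine ⟨fun u v => f u v + g u v, ?_, ?_, ?_, ?_⟩
  · intro u v
    have := hf.antisymm u v
    have := hg.antisymm u v
    omega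
  · intro u v h
    by_contra hadj
    have h1 := mt (hf.adj u v) hadj
    have h2 := mt (hg.adj u v) hadj
    omega
  · intro u v
    have h1 := hf.le_one u v
    have h2 := hg.le_one u v
    have h3 := hgR u v
    by_cases h : g u v = 1
    · have := (h3 h).2
      omega
    · omega
  · intro u
    rw [Finset.sum_add_distrib, hf.net, hg.net]
    push_cast
    ring

theorem exists_edgeDisjoint_paths {k : ℕ} {f : V → V → ℤ} (hf : IsUnitCapacityFlow G f a b k) :
    ∃ P : Fin k → G.Path a b,
      (∀ i u v, s(u, v) ∈ (P i : G.Walk a b).edges → f u v ≠ 0) ∧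
      ∀ i j, i ≠ j → ∀ e : Sym2 V, e ∈ (P i : G.Walk a b).edges →
        e ∉ (P j : G.Walk a b).edges := by
  induction k generalizing f with
  | zero => exact ⟨Fin.elim0, fun i => i.elim0, fun i => i.elim0⟩
  | succ k ih =>
    obtain ⟨p, g, hg, hgf, hpg⟩ := exists_path (G := G) (a := a) (b := b) (fun u v => f u v = 1)
      (fun u v h => hf.adj u v (by simp [h])) (by
        intro S ha hb
        by_contra! h
        have hle : ∑ u ∈ S, ∑ v ∈ Sᶜ, f u v ≤ 0 :=
          Finset.sum_nonpos fun u hu => Finset.sum_nonpos fun v hv => by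
            have := h u hu v (Finset.mem_compl.1 hv)
            have := hf.le_one u v
            omega
        rw [hf.sum_cut ha hb] at hle
        omega)
    have hfg : ∀ u v, g u v = 0 ∨ f u v = g u v ∧ f u v ≠ 0 := fun u v => by
      have h1 := hgf u v
      have h2 := hgf v u
      have h3 := hg.antisymm u v
      have h4 := hf.antisymm u v
      have h5 := hg.le_one u v
      have h6 := hg.le_one v u
      grind
    have hsub : IsUnitCapacityFlow G (fun u v => f u v - g u v) a b k := by
      refine ⟨?_, ?_, ?_, ?_⟩
      · intro u v
        have := hf.antisymm u v
        have := hg.antisymm u v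
        omega
      · intro u v h
        refine hf.adj u v ?_
        have := hfg u v
        omega
      · intro u v
        have := hfg u v
        have := hf.le_one u v
        omega
      · intro u
        rw [Finset.sum_sub_distrib, hf.net, hg.net]
        push_cast
        ring
    obtain ⟨P, hP, hdisj⟩ := ih hsub
    have hdisj_p : ∀ i e, e ∈ (P i : G.Walk a b).edges → e ∉ (p : G.Walk a b).edges := by
      intro i e
      induction e using Sym2.ind with
      | _ u v =>
        intro hi hp
        have h1 := hP i u v hi
        have h2 := hpg u v hp
        have := hfg u v
        omega
    refine ⟨Fin.cons p P, fun i u v => ?_, fun i j hij e => ?_⟩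
    · refine Fin.cases ?_ (fun i => ?_) i
      · intro h
        have h2 := hpg u v h
        have := hfg u v
        omega
      · intro h
        have h1 := hP i u v h
        have := hfg u v
        omega
    · induction i using Fin.cases with
      | zero =>
        induction j using Fin.cases with
        | zero => exact absurd rfl hij
        | succ j => exact fun hp hj => hdisj_p j e hj hp
      | succ i =>
        induction j using Fin.cases with
        | zero => exact hdisj_p i e
        | succ j => exact hdisj i j (fun h => hij (congrArg Fin.succ h)) e

end IsUnitCapacityFlow


/-- Edge-version of Menger's theorem: if every separating edge set for two
distinct vertices `a`, `b` of a finite connected simple graph has at least `τ`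
edges, then there are `τ` pairwise edge-disjoint paths from `a` to `b`. -/
theorem stmt_0 {V : Type*} [Fintype V] [DecidableEq V] (G : SimpleGraph V)
    (hG : G.Connected) (a b : V) (hab : a ≠ b) (τ : ℕ)
    (hsep : ∀ T : Set (Sym2 V), T ⊆ G.edgeSet →
      (∀ p : G.Path a b, ∃ e ∈ T, e ∈ (p : G.Walk a b).edges) → τ ≤ T.ncard) :
    ∃ P : Fin τ → G.Path a b, ∀ i j : Fin τ, i ≠ j →
      ∀ e : Sym2 V, e ∈ ((P i : G.Walk a b)).edges →
        e ∉ ((P j : G.Walk a b)).edges := by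
  have hflow : ∀ k : ℕ, k ≤ τ → ∃ f, IsUnitCapacityFlow G f a b k := by
    intro k
    induction k with
    | zero => exact fun _ => ⟨0, by simp, by simp, by simp, by simp⟩
    | succ k ih =>
      intro hk
      obtain ⟨f, hf⟩ := ih (by omega)
      exact hf.augment fun T hT hTp => lt_of_lt_of_le hk (hsep T hT hTp)
  obtain ⟨f, hf⟩ := hflow τ le_rfl
  obtain ⟨P, -, hP⟩ := hf.exists_edgeDisjoint_paths
  exact ⟨P, hP⟩
end

section
/- Let G be a finite connected simple graph and let a and b be two distinct vertices of G. Suppose that for every edge e of G, the vertices a and b remain connected by a path after deleting e from G. Then there exist two paths in G connecting a to b that are edge-disjoint. -/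
namespace SimpleGraph

variable {V : Type*} {G : SimpleGraph V}

/-- A walk starting in `S` has a final segment which starts in `S` and all of whose edges have an
endpoint outside `S`. -/
theorem Walk.exists_final_segment {u v : V} (r : G.Walk u v) (S : Set V) :
    (∀ x ∈ r.support, x ∉ S) ∨
      ∃ z ∈ S, ∃ t : G.Walk z v, t.edges ⊆ r.edges ∧ ∀ e ∈ t.edges, ∃ x ∈ e, x ∉ S := by
  induction r with
  | nil =>
    rename_i u
    by_cases hu : u ∈ S
    · exact .inr ⟨u, hu, .nil, by simp, by simp⟩
    · exact .inl (by simpa using hu)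
  | cons h r ih =>
    rename_i u w v
    rcases ih with ih | ⟨z, hz, t, ht, hS⟩
    · by_cases hu : u ∈ S
      · refine .inr ⟨u, hu, .cons h r, List.Subset.refl _, fun e he ↦ ?_⟩
        rw [Walk.edges_cons, List.mem_cons] at he
        rcases he with rfl | he
        · exact ⟨w, Sym2.mem_mk_right _ _, ih w r.start_mem_support⟩
        · induction e with
          | _ x y =>
            exact ⟨x, Sym2.mem_mk_left _ _, ih x (r.fst_mem_support_of_mem_edges he)⟩
      · refine .inl fun x hx ↦ ?_
        rw [Walk.support_cons, List.mem_cons] at hx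
        rcases hx with rfl | hx
        · exact hu
        · exact ih x hx
    · refine .inr ⟨z, hz, t, fun e he ↦ ?_, hS⟩
      rw [Walk.edges_cons]
      exact List.mem_cons_of_mem _ (ht he)

/-- There are two edge-disjoint walks from `a` to `b`. -/
def HasTwoEdgeDisjointWalks (G : SimpleGraph V) (a b : V) : Prop :=
  ∃ p q : G.Walk a b, p.edges.Disjoint q.edges

theorem HasTwoEdgeDisjointWalks.exists_paths [DecidableEq V] {a b : V}
    (h : G.HasTwoEdgeDisjointWalks a b) :
    ∃ p q : G.Path a b, (p : G.Walk a b).edges.Disjoint (q : G.Walk a b).edges := by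
  obtain ⟨p, q, hpq⟩ := h
  exact ⟨p.toPath, q.toPath, fun e hp hq ↦
    hpq (p.edges_toPath_subset_edges hp) (q.edges_toPath_subset_edges hq)⟩

/-- If the edge `s(x, y)` lies on one of two edge-disjoint paths to `x`, there are two edge-disjoint
walks to `y`. -/
theorem Walk.IsPath.hasTwoEdgeDisjointWalks_of_mem_edges {a x y : V} {p q : G.Walk a x}
    (hp : p.IsPath) (hpq : p.edges.Disjoint q.edges) (h : G.Adj x y)
    (he : s(x, y) ∈ p.edges) : G.HasTwoEdgeDisjointWalks a y := by
  classical
  have hy : y ∈ p.support := p.snd_mem_support_of_mem_edges he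
  have hx : x ∉ (p.takeUntil y hy).support :=
    Walk.endpoint_notMem_support_takeUntil hp hy h.ne
  refine ⟨p.takeUntil y hy, q.concat h, fun e hep heq ↦ ?_⟩
  rw [Walk.edges_concat, List.concat_eq_append, List.mem_append, List.mem_singleton] at heq
  rcases heq with heq | rfl
  · exact hpq (p.edges_takeUntil_subset_edges hy hep) heq
  · exact hx (Walk.fst_mem_support_of_mem_edges _ hep)

/-- Rerouting one of two edge-disjoint walks along a detour which is edge-disjoint from both. -/
theorem Walk.hasTwoEdgeDisjointWalks_of_detour {a x y z : V} {p q : G.Walk a x}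
    (hpq : p.edges.Disjoint q.edges) (h : G.Adj x y) (he : s(x, y) ∉ p.edges)
    (hz : z ∈ p.support) (t : G.Walk z y) (het : s(x, y) ∉ t.edges)
    (htq : t.edges.Disjoint q.edges) : G.HasTwoEdgeDisjointWalks a y := by
  classical
  refine ⟨(p.takeUntil z hz).append t, q.concat h, fun e hep heq ↦ ?_⟩
  rw [Walk.edges_append, List.mem_append] at hep
  rw [Walk.edges_concat, List.concat_eq_append, List.mem_append, List.mem_singleton] at heq
  rcases heq with heq | rfl <;> rcases hep with hep | hep
  · exact hpq (p.edges_takeUntil_subset_edges hz hep) heq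
  · exact htq hep heq
  · exact he (p.edges_takeUntil_subset_edges hz hep)
  · exact het hep

theorem HasTwoEdgeDisjointWalks.of_adj {a x y : V} (hx : G.HasTwoEdgeDisjointWalks a x)
    (h : G.Adj x y) (hy : G.IsEdgeReachable 2 a y) : G.HasTwoEdgeDisjointWalks a y := by
  classical
  obtain ⟨⟨p, hp⟩, ⟨q, hq⟩, hpq⟩ := hx.exists_paths
  dsimp only at hpq
  by_cases hep : s(x, y) ∈ p.edges
  · exact hp.hasTwoEdgeDisjointWalks_of_mem_edges hpq h hep
  by_cases heq : s(x, y) ∈ q.edges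
  · exact hq.hasTwoEdgeDisjointWalks_of_mem_edges hpq.symm h heq
  obtain ⟨r, hr⟩ : ∃ r : G.Walk a y, s(x, y) ∉ r.edges := by
    obtain ⟨r⟩ := isEdgeReachable_two.1 hy s(x, y)
    refine ⟨r.mapLe (deleteEdges_le _), fun hmem ↦ ?_⟩
    rw [Walk.edges_mapLe_eq_edges] at hmem
    simpa using r.edges_subset_edgeSet hmem
  rcases r.exists_final_segment {z | z ∈ p.support ∨ z ∈ q.support} with hS | ⟨z, hz, t, htr, hS⟩
  · exact absurd (.inl p.start_mem_support) (hS a r.start_mem_support)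
  have het : s(x, y) ∉ t.edges := fun hmem ↦ hr (htr hmem)
  have htp : t.edges.Disjoint p.edges := fun e het hep ↦ by
    obtain ⟨w, hw, hwS⟩ := hS e het
    exact hwS (.inl (p.mem_support_of_mem_edges hep hw))
  have htq : t.edges.Disjoint q.edges := fun e het heq ↦ by
    obtain ⟨w, hw, hwS⟩ := hS e het
    exact hwS (.inr (q.mem_support_of_mem_edges heq hw))
  rcases hz with hz | hz
  · exact Walk.hasTwoEdgeDisjointWalks_of_detour hpq h hep hz t het htq
  · exact Walk.hasTwoEdgeDisjointWalks_of_detour hpq.symm h heq hz t het htp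

theorem HasTwoEdgeDisjointWalks.of_walk {a x y : V} (hx : G.HasTwoEdgeDisjointWalks a x)
    (w : G.Walk x y) (hw : ∀ z ∈ w.support, G.IsEdgeReachable 2 a z) :
    G.HasTwoEdgeDisjointWalks a y := by
  induction w with
  | nil => exact hx
  | cons h w ih =>
    have hw' : ∀ z ∈ w.support, G.IsEdgeReachable 2 a z := fun z hz ↦
      hw z (by rw [Walk.support_cons]; exact List.mem_cons_of_mem _ hz)
    exact ih (hx.of_adj h (hw' _ w.start_mem_support)) hw'

/-- The edge version of Menger's theorem for two paths. -/
theorem IsEdgeReachable.hasTwoEdgeDisjointWalks {a b : V} (h : G.IsEdgeReachable 2 a b) :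
    G.HasTwoEdgeDisjointWalks a b := by
  obtain ⟨w, hw⟩ := (h.reachable two_ne_zero).exists_isPath
  have ha : G.HasTwoEdgeDisjointWalks a a := ⟨.nil, .nil, by simp⟩
  exact ha.of_walk w fun z hz ↦
    hw.isTrail.isEdgeReachable_two_of_isEdgeReachable_two h w.start_mem_support hz

end SimpleGraph


/-- If two distinct vertices `a`, `b` of a finite connected simple graph remain
connected after deleting any single edge, then there are two edge-disjoint
paths from `a` to `b`. -/
theorem stmt_1 {V : Type*} [Fintype V] [DecidableEq V] (G : SimpleGraph V)
    (hG : G.Connected) (a b : V) (hab : a ≠ b)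
    (hdel : ∀ e ∈ G.edgeSet, (G.deleteEdges {e}).Reachable a b) :
    ∃ p q : G.Path a b, ∀ e : Sym2 V,
      e ∈ (p : G.Walk a b).edges → e ∉ (q : G.Walk a b).edges := by
  have h : G.IsEdgeReachable 2 a b := by
    refine SimpleGraph.isEdgeReachable_two.2 fun e ↦ ?_
    by_cases he : e ∈ G.edgeSet
    · exact hdel e he
    · rw [SimpleGraph.deleteEdges_eq_self.2 (Set.disjoint_singleton_right.2 he)]
      exact hG a b
  obtain ⟨p, q, hpq⟩ := h.hasTwoEdgeDisjointWalks.exists_paths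
  exact ⟨p, q, fun e hp hq ↦ hpq hp hq⟩
end

section
/- Let H be a ℤ-module and let B : H →ₗ[ℤ] H →ₗ[ℤ] ℤ be a ℤ-bilinear form on H. Let ι be a finite index set, let x : ι → H be a family, and let V denote the set of nonzero values taken by x. Suppose that for every v ∈ V there exist elements a, b ∈ H such that B(a, v) = 1 and B(b, v) = 1, while for every index i ∈ ι with x i ≠ v one has B(a, x i) = 0 or B(b, x i) = 0. Then for a family n : ι → ℤ the following are equivalent: (1) for every z ∈ H, Σ_{i ∈ ι} n i · B(z, x i) · x i = 0 in H; (2) for every v ∈ V, Σ_{i : x i = v} n i = 0. -/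
/-- A Dehn multi-twist lies in the Torelli group iff the sum of its twisting
exponents over each necklace (class of components with a common nonzero
homology class) vanishes. -/
theorem stmt_4 {H : Type*} [AddCommGroup H] [Module ℤ H] [DecidableEq H]
    (B : H →ₗ[ℤ] H →ₗ[ℤ] ℤ) {ι : Type*} [Fintype ι]
    (x : ι → H)
    (V : Set H) (hV : V = {v : H | v ≠ 0 ∧ ∃ i : ι, x i = v})
    (hpair : ∀ v ∈ V, ∃ a b : H, B a v = 1 ∧ B b v = 1 ∧
      ∀ i : ι, x i ≠ v → (B a (x i) = 0 ∨ B b (x i) = 0))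
    (n : ι → ℤ) :
    (∀ z : H, ∑ i : ι, (n i * B z (x i)) • x i = 0) ↔
      (∀ v ∈ V, ∑ i ∈ Finset.univ.filter (fun i : ι => x i = v), n i = 0) := by
  obtain rfl : ‹Module ℤ H› = AddCommGroup.toIntModule H := Subsingleton.elim _ _
  constructor
  · intro h v hv
    obtain ⟨a, b, ha, hb, hab⟩ := hpair v hv
    have key : ∑ i, n i * B a (x i) * B b (x i) = 0 := by
      simpa [map_sum] using congrArg (B b) (h a)
    rw [← key, Finset.sum_filter]
    refine Finset.sum_congr rfl fun i _ => ?_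
    split_ifs with hi
    · simp [hi, ha, hb]
    · rcases hab i hi with h0 | h0 <;> simp [h0]
  · intro h z
    rw [← Finset.sum_fiberwise_of_maps_to
      (fun i _ => Finset.mem_image_of_mem x (Finset.mem_univ i))]
    refine Finset.sum_eq_zero fun v hv => ?_
    have hfib : ∑ i ∈ Finset.univ.filter (fun i => x i = v), (n i * B z (x i)) • x i =
        ((∑ i ∈ Finset.univ.filter (fun i => x i = v), n i) * B z v) • v := by
      rw [Finset.sum_mul, Finset.sum_smul]
      refine Finset.sum_congr rfl fun i hi => ?_
      rw [(Finset.mem_filter.mp hi).2]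
    rw [hfib]
    by_cases h0 : v = 0
    · simp [h0]
    · have hvV : v ∈ V := by
        obtain ⟨i, -, hi⟩ := Finset.mem_image.mp hv
        rw [hV]
        exact ⟨h0, i, hi⟩
      rw [h v hvV, zero_mul, zero_smul]
end
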